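/- arXiv:2507.08725 — 2 statements merged into one kernel-verified Lean document; each statement's English description precedes it below -/
import Mathlib

section
/- Define E' = E ∪ { e + Σ_{k=r}^{u} ω(v_k) : e ∈ E, 1 ≤ r ≤ u ≤ n } ∪ { e − Σ_{k=u+1}^{s} ω(v_k) : e ∈ E, 1 ≤ u < s ≤ n, the difference being nonnegative }. Then: (i) in every E-schedule σ, the completion time σ(v_u) + ω(v_u) of every task v_u belongs to E'; (ii) |E'| ≤ (J+1)(n² + 1); and (iii) if Σ_{i=1}^{n} ω(v_i) ≤ T, there exists an optimal feasible schedule in which every task's completion time belongs to E'. -/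
/-!
Single-processor carbon-aware scheduling: the refined set `E'` of candidate task
end times contains all task completion times of any `E`-schedule, has at most
`(J+1)(n²+1)` elements, and (when a feasible schedule exists) supports an optimal
schedule.
-/

/-- A feasible schedule: tasks are executed in order without overlap,
and the last task completes by the deadline `T`. -/
def Feasible (n T : ℕ) (ω : ℕ → ℕ) (σ : ℕ → ℕ) : Prop :=
  (∀ i, i + 1 < n → σ i + ω i ≤ σ (i + 1)) ∧ (0 < n → σ (n - 1) + ω (n - 1) ≤ T)

/-- The processor is active at time unit `t`. -/
def Active (n : ℕ) (ω : ℕ → ℕ) (σ : ℕ → ℕ) (t : ℕ) : Prop :=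
  ∃ i < n, σ i ≤ t ∧ t < σ i + ω i

/-- Power consumed at time unit `t`. -/
noncomputable def Power (n : ℕ) (ω : ℕ → ℕ) (Pidle Pwork : ℕ) (σ : ℕ → ℕ) (t : ℕ) : ℕ :=
  @ite ℕ (Active n ω σ t) (Classical.propDecidable _) (Pidle + Pwork) Pidle

/-- Carbon cost of a schedule: `∑_{t<T} max(P(t) - G(t), 0)`. -/
noncomputable def CC (n T : ℕ) (ω : ℕ → ℕ) (Pidle Pwork : ℕ) (G : ℕ → ℕ) (σ : ℕ → ℕ) : ℕ :=
  ∑ t ∈ Finset.range T, (Power n ω Pidle Pwork σ t - G t)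

/-- `v_r, …, v_s` form a block of σ: a maximal run of back-to-back tasks. -/
def IsBlock (n : ℕ) (ω : ℕ → ℕ) (σ : ℕ → ℕ) (r s : ℕ) : Prop :=
  r ≤ s ∧ s < n ∧
  (∀ i, r ≤ i → i < s → σ (i + 1) = σ i + ω i) ∧
  (r = 0 ∨ σ (r - 1) + ω (r - 1) < σ r) ∧
  (s = n - 1 ∨ σ s + ω s < σ (s + 1))

/-- The set `E` of interval boundaries. -/
def ESet (J : ℕ) (bnd : ℕ → ℕ) : Set ℕ :=
  {e | ∃ j ≤ J, bnd j = e}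

/-- An `E`-schedule: a feasible schedule each of whose blocks starts or ends
at an interval boundary. -/
def ESchedule (n T J : ℕ) (ω : ℕ → ℕ) (bnd : ℕ → ℕ) (σ : ℕ → ℕ) : Prop :=
  Feasible n T ω σ ∧
  ∀ r s, IsBlock n ω σ r s → σ r ∈ ESet J bnd ∨ σ s + ω s ∈ ESet J bnd

/-- The refined set `E'` of candidate task end times:
`E ∪ {e + Σ_{k=r}^{u} ω k : e ∈ E, r ≤ u < n} ∪ {e - Σ_{k=u+1}^{s} ω k : e ∈ E, u < s < n}`
(the last only when the difference is nonnegative).  Indices of tasks are `0`-based. -/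
def ESet' (n J : ℕ) (ω : ℕ → ℕ) (bnd : ℕ → ℕ) : Set ℕ :=
  ESet J bnd
    ∪ {x | ∃ e ∈ ESet J bnd, ∃ r u, r ≤ u ∧ u < n ∧
        x = e + ∑ k ∈ Finset.Icc r u, ω k}
    ∪ {x | ∃ e ∈ ESet J bnd, ∃ u s, u < s ∧ s < n ∧
        (∑ k ∈ Finset.Icc (u + 1) s, ω k) ≤ e ∧
        x = e - ∑ k ∈ Finset.Icc (u + 1) s, ω k}

theorem Feasible.add_le {n T : ℕ} {ω σ : ℕ → ℕ} (h : Feasible n T ω σ) {i j : ℕ}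
    (hij : i < j) (hj : j < n) : σ i + ω i ≤ σ j := by
  induction j, hij using Nat.le_induction with
  | base => exact h.1 i hj
  | succ k hk ih =>
    have h₁ := ih (by omega)
    have h₂ := h.1 k hj
    omega

theorem Feasible.add_le_deadline {n T : ℕ} {ω σ : ℕ → ℕ} (h : Feasible n T ω σ) {i : ℕ}
    (hi : i < n) : σ i + ω i ≤ T := by
  have h₂ := h.2 (by omega)
  rcases Nat.lt_or_ge i (n - 1) with h₁ | h₁
  · have h₃ := h.add_le h₁ (by omega)
    omega
  · obtain rfl : i = n - 1 := by omega
    exact h₂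

theorem feasible_sum_range {n T : ℕ} {ω : ℕ → ℕ} (h : ∑ i ∈ Finset.range n, ω i ≤ T) :
    Feasible n T ω (fun i => ∑ k ∈ Finset.range i, ω k) := by
  refine ⟨fun i _ => (Finset.sum_range_succ ω i).ge, fun hn => ?_⟩
  rw [← Finset.sum_range_succ, Nat.sub_add_cancel hn]
  exact h

/-- The extra carbon cost of being active at time unit `t`. -/
def workCost (Pidle Pwork : ℕ) (G : ℕ → ℕ) (t : ℕ) : ℕ :=
  (Pidle + Pwork - G t) - (Pidle - G t)

theorem Feasible.CC_eq {n T : ℕ} {ω σ : ℕ → ℕ} (h : Feasible n T ω σ) (Pidle Pwork : ℕ)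
    (G : ℕ → ℕ) :
    CC n T ω Pidle Pwork G σ = ∑ t ∈ Finset.range T, (Pidle - G t) +
      ∑ i ∈ Finset.range n, ∑ t ∈ Finset.Ico (σ i) (σ i + ω i), workCost Pidle Pwork G t := by
  classical
  have hdisj : (↑(Finset.range n) : Set ℕ).PairwiseDisjoint
      (fun i => Finset.Ico (σ i) (σ i + ω i)) := by
    intro i hi j hj hij
    rw [Finset.mem_coe, Finset.mem_range] at hi hj
    refine Finset.disjoint_left.2 fun t ht ht' => ?_
    rw [Finset.mem_Ico] at ht ht'
    rcases Nat.lt_or_gt_of_ne hij with hlt | hlt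
    · have := h.add_le hlt hj
      omega
    · have := h.add_le hlt hi
      omega
  have hset : (Finset.range n).biUnion (fun i => Finset.Ico (σ i) (σ i + ω i)) =
      (Finset.range T).filter (Active n ω σ) := by
    ext t
    simp only [Finset.mem_biUnion, Finset.mem_range, Finset.mem_Ico, Finset.mem_filter, Active]
    constructor
    · rintro ⟨i, hi, ht⟩
      have := h.add_le_deadline hi
      exact ⟨by omega, i, hi, ht⟩
    · rintro ⟨-, i, hi, ht⟩
      exact ⟨i, hi, ht⟩
  rw [← Finset.sum_biUnion hdisj, hset, Finset.sum_filter, ← Finset.sum_add_distrib]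
  refine Finset.sum_congr rfl fun t _ => ?_
  by_cases ha : Active n ω σ t
  · simp only [Power, ha, if_true, workCost]
    omega
  · simp [Power, ha]

theorem sum_Icc_of_contiguous {ω σ : ℕ → ℕ} {r s : ℕ} (hrs : r ≤ s)
    (h : ∀ i, r ≤ i → i < s → σ (i + 1) = σ i + ω i) (c : ℕ → ℕ) :
    ∑ i ∈ Finset.Icc r s, ∑ t ∈ Finset.Ico (σ i) (σ i + ω i), c t =
      ∑ t ∈ Finset.Ico (σ r) (σ s + ω s), c t := by
  induction s, hrs using Nat.le_induction with
  | base => simp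
  | succ k hk ih =>
    have hle : σ r ≤ σ k := by
      clear ih
      induction k, hk using Nat.le_induction with
      | base => exact le_rfl
      | succ m hm ihm =>
        have h₁ := ihm fun i hi hi' => h i hi (by omega)
        have h₂ := h m hm (by omega)
        omega
    rw [Finset.sum_Icc_succ_top (by omega), ih fun i hi hi' => h i hi (by omega),
      h k hk (by omega)]
    exact Finset.sum_Ico_consecutive c (by omega) (by omega)

theorem add_sum_Icc_of_contiguous {ω σ : ℕ → ℕ} {r s : ℕ} (hrs : r ≤ s)
    (h : ∀ i, r ≤ i → i < s → σ (i + 1) = σ i + ω i) :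
    σ s + ω s = σ r + ∑ k ∈ Finset.Icc r s, ω k := by
  induction s, hrs using Nat.le_induction with
  | base => simp
  | succ k hk ih =>
    rw [Finset.sum_Icc_succ_top (by omega), h k hk (by omega),
      ih fun i hi hi' => h i hi (by omega)]
    ring

theorem Feasible.exists_isBlock {n T : ℕ} {ω σ : ℕ → ℕ} (h : Feasible n T ω σ) {u : ℕ}
    (hu : u < n) : ∃ r s, r ≤ u ∧ u ≤ s ∧ IsBlock n ω σ r s := by
  have hleft : ∀ u, u < n → ∃ r ≤ u, (∀ i, r ≤ i → i < u → σ (i + 1) = σ i + ω i) ∧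
      (r = 0 ∨ σ (r - 1) + ω (r - 1) < σ r) := by
    intro u
    induction u with
    | zero => exact fun _ => ⟨0, le_rfl, by omega, Or.inl rfl⟩
    | succ u ih =>
      intro hu
      rcases (h.1 u hu).eq_or_lt with he | hlt
      · obtain ⟨r, hr, hc, hg⟩ := ih (by omega)
        refine ⟨r, by omega, fun i hi hi' => ?_, hg⟩
        rcases Nat.lt_or_ge i u with h' | h'
        · exact hc i hi h'
        · obtain rfl : i = u := by omega
          exact he.symm
      · exact ⟨u + 1, le_rfl, by omega, Or.inr hlt⟩
  have hright : ∀ d u, u + d = n - 1 → u < n →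
      ∃ s, u ≤ s ∧ s < n ∧ (∀ i, u ≤ i → i < s → σ (i + 1) = σ i + ω i) ∧
      (s = n - 1 ∨ σ s + ω s < σ (s + 1)) := by
    intro d
    induction d with
    | zero => exact fun u hd hu => ⟨u, le_rfl, hu, by omega, Or.inl hd⟩
    | succ d ih =>
      intro u hd hu
      rcases (h.1 u (by omega)).eq_or_lt with he | hlt
      · obtain ⟨s, hs, hsn, hc, hg⟩ := ih (u + 1) (by omega) (by omega)
        refine ⟨s, by omega, hsn, fun i hi hi' => ?_, hg⟩
        rcases hi.eq_or_lt with rfl | h'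
        · exact he.symm
        · exact hc i h' hi'
      · exact ⟨u, le_rfl, hu, by omega, Or.inr hlt⟩
  obtain ⟨r, hr, hcr, hgr⟩ := hleft u hu
  obtain ⟨s, hs, hsn, hcs, hgs⟩ := hright (n - 1 - u) u (by omega) hu
  refine ⟨r, s, hr, hs, by omega, hsn, fun i hi hi' => ?_, hgr, hgs⟩
  rcases Nat.lt_or_ge i u with h' | h'
  · exact hcr i hi h'
  · exact hcs i h' hi'

theorem ESchedule.add_mem_ESet' {n T J : ℕ} {ω bnd σ : ℕ → ℕ}
    (h : ESchedule n T J ω bnd σ) {u : ℕ} (hu : u < n) : σ u + ω u ∈ ESet' n J ω bnd := by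
  obtain ⟨r, s, hr, hs, hb⟩ := h.1.exists_isBlock hu
  obtain ⟨-, hsn, hc, -, -⟩ := id hb
  rcases h.2 r s hb with he | he
  · exact Or.inl (Or.inr ⟨σ r, he, r, u, hr, hu,
      add_sum_Icc_of_contiguous hr fun i hi hi' => hc i hi (by omega)⟩)
  · rcases hs.eq_or_lt with rfl | hlt
    · exact Or.inl (Or.inl he)
    · have h₁ := add_sum_Icc_of_contiguous (σ := σ) (ω := ω) (r := u + 1) (s := s) hlt
        fun i hi hi' => hc i (by omega) hi'
      have h₂ := hc u hr hlt
      exact Or.inr ⟨σ s + ω s, he, u, s, hlt, hsn, by omega, by omega⟩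

theorem ncard_ESet'_le (n J : ℕ) (ω bnd : ℕ → ℕ) :
    (ESet' n J ω bnd).ncard ≤ (J + 1) * (n ^ 2 + 1) := by
  classical
  let g : ℕ × Option (ℕ × ℕ) → ℕ := fun p =>
    match p.2 with
    | none => bnd p.1
    | some (a, b) =>
      if a ≤ b then bnd p.1 + ∑ k ∈ Finset.Icc a b, ω k
      else bnd p.1 - ∑ k ∈ Finset.Icc (b + 1) a, ω k
  let D : Finset (ℕ × Option (ℕ × ℕ)) :=
    Finset.range (J + 1) ×ˢ Finset.insertNone (Finset.range n ×ˢ Finset.range n)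
  have hsub : ESet' n J ω bnd ⊆ ↑(D.image g) := by
    intro x hx
    rw [Finset.mem_coe, Finset.mem_image]
    rcases hx with (⟨j, hj, rfl⟩ | ⟨-, ⟨j, hj, rfl⟩, r, u, hru, hu, rfl⟩) |
      ⟨-, ⟨j, hj, rfl⟩, u, s, hus, hs, -, rfl⟩
    · exact ⟨(j, none), by simp [D]; omega, rfl⟩
    · exact ⟨(j, some (r, u)), by simp [D]; omega, if_pos hru⟩
    · exact ⟨(j, some (s, u)), by simp [D]; omega, if_neg (by omega)⟩
  calc (ESet' n J ω bnd).ncard ≤ (↑(D.image g) : Set ℕ).ncard :=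
        Set.ncard_le_ncard hsub (Finset.finite_toSet _)
    _ = (D.image g).card := Set.ncard_coe_finset _
    _ ≤ D.card := Finset.card_image_le
    _ = (J + 1) * (n ^ 2 + 1) := by
      simp [D, Finset.card_product, Finset.card_insertNone, sq]

theorem eq_pred_of_not_mem_ESet {T J : ℕ} {bnd 𝒢 G : ℕ → ℕ} (hbnd0 : bnd 0 = 0)
    (hbndJ : bnd J = T)
    (hG : ∀ j, j < J → ∀ t, bnd j ≤ t → t < bnd (j + 1) → G t = 𝒢 j) {t : ℕ}
    (ht : t < T) (hE : t ∉ ESet J bnd) : G t = G (t - 1) := by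
  have hex : ∀ m, m ≤ J → t < bnd m → ∃ j < J, bnd j ≤ t ∧ t < bnd (j + 1) := by
    intro m
    induction m with
    | zero => intro _ h; omega
    | succ m ih =>
      intro hm h
      rcases Nat.lt_or_ge t (bnd m) with h' | h'
      · exact ih (by omega) h'
      · exact ⟨m, hm, h', h⟩
  obtain ⟨j, hj, h₁, h₂⟩ := hex J le_rfl (hbndJ ▸ ht)
  have hne : bnd j ≠ t := fun h => hE ⟨j, hj.le, h⟩
  rw [hG j hj t h₁ h₂, hG j hj (t - 1) (by omega) (by omega)]

/-- Apply `f` to the start times of the tasks `v_r, …, v_s`, leaving the others unchanged. -/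
def moveBlock (σ : ℕ → ℕ) (r s : ℕ) (f : ℕ → ℕ) (i : ℕ) : ℕ :=
  if r ≤ i ∧ i ≤ s then f (σ i) else σ i

/-- Moving a contiguous run of tasks changes the cost only through the time units it covers. -/
theorem CC_moveBlock_add {n T : ℕ} {ω σ : ℕ → ℕ} {r s : ℕ} (hrs : r ≤ s) (hs : s < n)
    (h : Feasible n T ω σ) (f : ℕ → ℕ)
    (hc : ∀ i, r ≤ i → i < s → σ (i + 1) = σ i + ω i)
    (hf : ∀ i, r ≤ i → i < s → f (σ i + ω i) = f (σ i) + ω i)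
    (h' : Feasible n T ω (moveBlock σ r s f)) (Pidle Pwork : ℕ) (G : ℕ → ℕ) :
    CC n T ω Pidle Pwork G (moveBlock σ r s f) +
        ∑ t ∈ Finset.Ico (σ r) (σ s + ω s), workCost Pidle Pwork G t =
      CC n T ω Pidle Pwork G σ +
        ∑ t ∈ Finset.Ico (f (σ r)) (f (σ s) + ω s), workCost Pidle Pwork G t := by
  have hsub : Finset.Icc r s ⊆ Finset.range n := fun i hi => by
    rw [Finset.mem_Icc] at hi
    rw [Finset.mem_range]
    omega
  have hin : ∀ i, r ≤ i → i ≤ s → moveBlock σ r s f i = f (σ i) := fun i h₁ h₂ =>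
    if_pos ⟨h₁, h₂⟩
  have hc' : ∀ i, r ≤ i → i < s →
      moveBlock σ r s f (i + 1) = moveBlock σ r s f i + ω i := by
    intro i h₁ h₂
    rw [hin i h₁ h₂.le, hin (i + 1) (by omega) (by omega), hc i h₁ h₂, hf i h₁ h₂]
  have hout : ∑ i ∈ Finset.range n \ Finset.Icc r s,
        ∑ t ∈ Finset.Ico (moveBlock σ r s f i) (moveBlock σ r s f i + ω i),
          workCost Pidle Pwork G t =
      ∑ i ∈ Finset.range n \ Finset.Icc r s,
        ∑ t ∈ Finset.Ico (σ i) (σ i + ω i), workCost Pidle Pwork G t := by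
    refine Finset.sum_congr rfl fun i hi => ?_
    rw [Finset.mem_sdiff, Finset.mem_Icc] at hi
    rw [moveBlock, if_neg hi.2]
  rw [h.CC_eq, h'.CC_eq, ← Finset.sum_sdiff hsub, ← Finset.sum_sdiff hsub, hout,
    sum_Icc_of_contiguous hrs hc, sum_Icc_of_contiguous hrs hc', hin r le_rfl hrs,
    hin s hrs le_rfl]
  ring

theorem IsBlock.feasible_moveBlock {n T : ℕ} {ω σ : ℕ → ℕ} {r s : ℕ}
    (hb : IsBlock n ω σ r s) (h : Feasible n T ω σ) {f : ℕ → ℕ}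
    (hf : ∀ i, r ≤ i → i < s → f (σ i + ω i) = f (σ i) + ω i)
    (hl : σ r ≤ f (σ r) + 1) (hr : f (σ s) ≤ σ s + 1) (hT : f (σ s) + ω s ≤ T) :
    Feasible n T ω (moveBlock σ r s f) := by
  obtain ⟨hrs, hsn, hc, hgl, hgr⟩ := hb
  refine ⟨fun i hi => ?_, fun hn => ?_⟩
  · have h₀ := h.1 i hi
    rcases Nat.lt_trichotomy (i + 1) r with h₁ | h₁ | h₁
    · rw [moveBlock, moveBlock, if_neg (by omega), if_neg (by omega)]
      exact h₀
    · subst h₁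
      rw [moveBlock, moveBlock, if_neg (by omega), if_pos (by omega)]
      rw [Nat.add_sub_cancel] at hgl
      omega
    · rcases Nat.lt_trichotomy i s with h₂ | rfl | h₂
      · rw [moveBlock, moveBlock, if_pos (by omega), if_pos (by omega), hc i (by omega) h₂,
          hf i (by omega) h₂]
      · rw [moveBlock, moveBlock, if_pos (by omega), if_neg (by omega)]
        omega
      · rw [moveBlock, moveBlock, if_neg (by omega), if_neg (by omega)]
        exact h₀
  · have h₀ := h.2 hn
    rw [moveBlock]
    split_ifs with h₁
    · obtain rfl : s = n - 1 := by omega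
      exact hT
    · exact h₀

/-- A block with both ends off the interval boundaries can be moved one time unit to the left
without leaving the set of optimal schedules. -/
theorem IsBlock.exists_optimal_left {n T J : ℕ} {ω bnd 𝒢 G : ℕ → ℕ} {Pidle Pwork : ℕ}
    {σ : ℕ → ℕ} {r s : ℕ} (hω : ∀ i, i < n → 0 < ω i)
    (hbnd0 : bnd 0 = 0) (hbndJ : bnd J = T)
    (hG : ∀ j, j < J → ∀ t, bnd j ≤ t → t < bnd (j + 1) → G t = 𝒢 j)
    (hb : IsBlock n ω σ r s) (h : Feasible n T ω σ)
    (hopt : ∀ τ, Feasible n T ω τ → CC n T ω Pidle Pwork G σ ≤ CC n T ω Pidle Pwork G τ)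
    (hr : σ r ∉ ESet J bnd) (hs : σ s + ω s ∉ ESet J bnd) :
    ∃ τ, Feasible n T ω τ ∧ CC n T ω Pidle Pwork G τ ≤ CC n T ω Pidle Pwork G σ ∧
      ∑ i ∈ Finset.range n, τ i < ∑ i ∈ Finset.range n, σ i := by
  have hrs := hb.1
  have hsn := hb.2.1
  have hc := hb.2.2.1
  have hle : ∀ i, r ≤ i → i ≤ s → σ r ≤ σ i := fun i h₁ h₂ => by
    rcases h₁.eq_or_lt with rfl | h₃
    · exact le_rfl
    · have := h.add_le h₃ (by omega)
      omega
  have hpos : 0 < σ r := Nat.pos_of_ne_zero fun h₀ => hr ⟨0, Nat.zero_le _, by rw [hbnd0, h₀]⟩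
  have hwr := hω r (by omega)
  have hws := hω s hsn
  have hrT := h.add_le_deadline (i := r) (by omega)
  have hsT : σ s + ω s < T := by
    refine lt_of_le_of_ne (h.add_le_deadline hsn) fun h₀ => hs ⟨J, le_rfl, by rw [hbndJ, h₀]⟩
  have hls := hle s hrs le_rfl
  have hfl : Feasible n T ω (moveBlock σ r s (· - 1)) :=
    hb.feasible_moveBlock h
      (fun i h₁ h₂ => by have := hle i h₁ h₂.le; omega)
      (by omega) (by omega) (by omega)
  have hfr : Feasible n T ω (moveBlock σ r s (· + 1)) :=
    hb.feasible_moveBlock h (fun i _ _ => by omega)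
      (by omega) (by omega) (by omega)
  have hcl := CC_moveBlock_add hrs hsn h (· - 1) hc
    (fun i h₁ h₂ => by have := hle i h₁ h₂.le; omega) hfl Pidle Pwork G
  have hcr := CC_moveBlock_add hrs hsn h (· + 1) hc
    (fun i _ _ => by omega) hfr Pidle Pwork G
  have hor := hopt _ hfr
  have hGr := eq_pred_of_not_mem_ESet hbnd0 hbndJ hG (by omega) hr
  have hGs := eq_pred_of_not_mem_ESet hbnd0 hbndJ hG hsT hs
  have hwcr : workCost Pidle Pwork G (σ r) = workCost Pidle Pwork G (σ r - 1) := by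
    rw [workCost, workCost, hGr]
  have hwcs : workCost Pidle Pwork G (σ s + ω s) =
      workCost Pidle Pwork G (σ s + ω s - 1) := by
    rw [workCost, workCost, hGs]
  refine ⟨_, hfl, ?_, ?_⟩
  · generalize workCost Pidle Pwork G = c at *
    have e₁ := Finset.sum_eq_sum_Ico_succ_bot (show σ r - 1 < σ s + ω s - 1 by omega) c
    have e₂ := Finset.sum_Ico_succ_top (show σ r ≤ σ s + ω s - 1 by omega) c
    have e₃ := Finset.sum_eq_sum_Ico_succ_bot (show σ r < σ s + ω s by omega) c
    have e₄ := Finset.sum_Ico_succ_top (show σ r + 1 ≤ σ s + ω s by omega) c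
    rw [Nat.sub_add_cancel hpos] at e₁
    rw [Nat.sub_add_cancel (show 1 ≤ σ s + ω s by omega)] at e₂
    have a₁ : σ s - 1 + ω s = σ s + ω s - 1 := by omega
    have a₂ : σ s + 1 + ω s = σ s + ω s + 1 := by omega
    rw [a₁] at hcl
    rw [a₂] at hcr
    omega
  · refine Finset.sum_lt_sum (fun i _ => ?_) ⟨r, Finset.mem_range.2 (by omega), ?_⟩
    · rw [moveBlock]
      split_ifs <;> omega
    · rw [moveBlock, if_pos ⟨le_rfl, hrs⟩]
      omega

theorem exists_optimal_eSchedule {n T J : ℕ} {ω bnd 𝒢 G : ℕ → ℕ} (Pidle Pwork : ℕ)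
    (hω : ∀ i, i < n → 0 < ω i) (hbnd0 : bnd 0 = 0) (hbndJ : bnd J = T)
    (hG : ∀ j, j < J → ∀ t, bnd j ≤ t → t < bnd (j + 1) → G t = 𝒢 j)
    (hT : ∑ i ∈ Finset.range n, ω i ≤ T) :
    ∃ σ, ESchedule n T J ω bnd σ ∧
      ∀ τ, Feasible n T ω τ → CC n T ω Pidle Pwork G σ ≤ CC n T ω Pidle Pwork G τ := by
  have hmin : ∀ (S : Set (ℕ → ℕ)) (F : (ℕ → ℕ) → ℕ), S.Nonempty →
      ∃ a ∈ S, ∀ b ∈ S, F a ≤ F b := fun S F hS =>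
    ⟨Function.argminOn F S hS, Function.argminOn_mem F S hS,
      fun b hb => Function.argminOn_le F S hb⟩
  obtain ⟨σ₀, hσ₀, hopt₀⟩ := hmin {σ | Feasible n T ω σ} (CC n T ω Pidle Pwork G)
    ⟨_, feasible_sum_range hT⟩
  obtain ⟨σ, ⟨hσ, hopt⟩, hleast⟩ := hmin
    {σ | Feasible n T ω σ ∧
      ∀ τ, Feasible n T ω τ → CC n T ω Pidle Pwork G σ ≤ CC n T ω Pidle Pwork G τ}
    (fun σ => ∑ i ∈ Finset.range n, σ i) ⟨σ₀, hσ₀, hopt₀⟩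
  refine ⟨σ, ⟨hσ, fun r s hb => ?_⟩, hopt⟩
  by_contra! hE
  obtain ⟨τ, hτ, hle, hlt⟩ :=
    hb.exists_optimal_left hω hbnd0 hbndJ hG hσ hopt hE.1 hE.2
  exact (hleast τ ⟨hτ, fun ρ hρ => hle.trans (hopt ρ hρ)⟩).not_gt hlt

/-- (i) In every `E`-schedule every task completion time belongs to `E'`;
(ii) `|E'| ≤ (J+1)(n²+1)`; (iii) if `Σ ω ≤ T`, there is an optimal feasible
schedule all of whose task completion times belong to `E'`. -/
theorem ESet'_spec
    (n T J : ℕ) (ω : ℕ → ℕ) (bnd : ℕ → ℕ) (𝒢 : ℕ → ℕ) (G : ℕ → ℕ) (Pidle Pwork : ℕ)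
    (hω : ∀ i, i < n → 0 < ω i)
    (hbnd0 : bnd 0 = 0) (hbndJ : bnd J = T)
    (hmono : ∀ j, j < J → bnd j < bnd (j + 1))
    (hG : ∀ j, j < J → ∀ t, bnd j ≤ t → t < bnd (j + 1) → G t = 𝒢 j) :
    (∀ σ : ℕ → ℕ, ESchedule n T J ω bnd σ →
        ∀ u, u < n → σ u + ω u ∈ ESet' n J ω bnd) ∧
    (ESet' n J ω bnd).ncard ≤ (J + 1) * (n ^ 2 + 1) ∧
    (∑ i ∈ Finset.range n, ω i ≤ T →
      ∃ σ : ℕ → ℕ, Feasible n T ω σ ∧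
        (∀ τ : ℕ → ℕ, Feasible n T ω τ →
          CC n T ω Pidle Pwork G σ ≤ CC n T ω Pidle Pwork G τ) ∧
        ∀ u, u < n → σ u + ω u ∈ ESet' n J ω bnd) := by
  refine ⟨fun σ hσ u hu => hσ.add_mem_ESet' hu, ncard_ESet'_le n J ω bnd, fun hT => ?_⟩
  obtain ⟨σ, hσ, hopt⟩ := exists_optimal_eSchedule Pidle Pwork hω hbnd0 hbndJ hG hT
  exact ⟨σ, hσ.1, hopt, fun u hu => hσ.add_mem_ESet' hu⟩
end

section
/- If the associated UCAS instance has a schedule of carbon cost 0, then x admits a 3-partition. -/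
/-!
Zero-cost UCAS schedule ⟹ 3-Partition: if the UCAS instance associated with a
3-Partition instance admits a schedule of carbon cost `0`, then `x` admits a
3-partition.
-/

/-- Horizon of the UCAS instance associated with a 3-Partition instance. -/
def ucasT (n B : ℕ) : ℕ := n * B + n - 1

/-- Green power budget at time unit `t`: `1` on green units, `0` on separators. -/
def green (B t : ℕ) : ℕ := if t % (B + 1) < B then 1 else 0

/-- σ is a valid schedule: every task completes by the horizon. -/
def IsSchedule (n B : ℕ) (x σ : Fin (3 * n) → ℕ) : Prop :=
  ∀ i, σ i + x i ≤ ucasT n B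

/-- Number of tasks active at time unit `t`. -/
def ActiveCount (n : ℕ) (x σ : Fin (3 * n) → ℕ) (t : ℕ) : ℕ :=
  (Finset.univ.filter fun i : Fin (3 * n) => σ i ≤ t ∧ t < σ i + x i).card

/-- Total carbon cost of σ: `∑_{t<T} max(A(t) - g(t), 0)`. -/
def carbonCost (n B : ℕ) (x σ : Fin (3 * n) → ℕ) : ℕ :=
  ∑ t ∈ Finset.range (ucasT n B), (ActiveCount n x σ t - green B t)

/-- `x` admits a 3-partition: a partition of the `3n` indices into `n` subsets,
each summing to `B`. -/
def ThreePartition (n B : ℕ) (x : Fin (3 * n) → ℕ) : Prop :=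
  ∃ S : Fin n → Finset (Fin (3 * n)),
    (∀ i, ∃! k, i ∈ S k) ∧ ∀ k, ∑ i ∈ S k, x i = B

theorem green_le_one (B t : ℕ) : green B t ≤ 1 := by
  unfold green
  split <;> simp

theorem activeCount_le_green {n B : ℕ} {x σ : Fin (3 * n) → ℕ}
    (hcost : carbonCost n B x σ = 0) {t : ℕ} (ht : t < ucasT n B) :
    ActiveCount n x σ t ≤ green B t :=
  Nat.sub_eq_zero_iff_le.mp (Finset.sum_eq_zero_iff.mp hcost t (Finset.mem_range.mpr ht))

/-- In a zero-cost schedule, no task is running at a separator. -/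
theorem mod_add_le_of_carbonCost_eq_zero {n B : ℕ} {x σ : Fin (3 * n) → ℕ}
    (hvalid : IsSchedule n B x σ) (hcost : carbonCost n B x σ = 0) (i : Fin (3 * n)) :
    σ i % (B + 1) + x i ≤ B := by
  by_contra! h
  have hdiv := Nat.div_add_mod (σ i) (B + 1)
  have hmod : σ i % (B + 1) < B + 1 := Nat.mod_lt _ (Nat.succ_pos B)
  set t := (B + 1) * (σ i / (B + 1)) + B with ht
  have hend : t < σ i + x i := by omega
  have hgreen : green B t = 0 := by
    simp [green, ht]
  have hle := activeCount_le_green hcost (hend.trans_le (hvalid i))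
  have hpos : 0 < ActiveCount n x σ t :=
    Finset.card_pos.mpr ⟨i, by simp only [Finset.mem_filter_univ]; omega⟩
  omega

/-- In a zero-cost schedule, distinct tasks never run simultaneously. -/
theorem disjoint_Ico_of_carbonCost_eq_zero {n B : ℕ} {x σ : Fin (3 * n) → ℕ}
    (hvalid : IsSchedule n B x σ) (hcost : carbonCost n B x σ = 0) {i j : Fin (3 * n)}
    (hij : i ≠ j) :
    Disjoint (Finset.Ico (σ i) (σ i + x i)) (Finset.Ico (σ j) (σ j + x j)) := by
  refine Finset.disjoint_left.mpr fun t hti htj => hij ?_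
  rw [Finset.mem_Ico] at hti htj
  have hcard := (activeCount_le_green hcost (hti.2.trans_le (hvalid i))).trans
    (green_le_one B t)
  exact Finset.card_le_one.mp hcard i (by simpa using hti) j (by simpa using htj)

/-- In a zero-cost schedule, the tasks starting in a given block have total duration at most
`B`. -/
theorem sum_block_le_of_carbonCost_eq_zero {n B : ℕ} {x σ : Fin (3 * n) → ℕ}
    (hvalid : IsSchedule n B x σ) (hcost : carbonCost n B x σ = 0) (k : ℕ) :
    ∑ i with σ i / (B + 1) = k, x i ≤ B := by
  calc ∑ i with σ i / (B + 1) = k, x i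
      = ((Finset.univ.filter fun i => σ i / (B + 1) = k).biUnion
          fun i => Finset.Ico (σ i) (σ i + x i)).card := by
        rw [Finset.card_biUnion fun i _ j _ hij =>
          disjoint_Ico_of_carbonCost_eq_zero hvalid hcost hij]
        simp
    _ ≤ (Finset.Ico ((B + 1) * k) ((B + 1) * k + B)).card := by
        refine Finset.card_le_card (Finset.biUnion_subset.mpr fun i hi t ht => ?_)
        obtain rfl := (Finset.mem_filter.mp hi).2
        have hdiv := Nat.div_add_mod (σ i) (B + 1)
        have hmod := mod_add_le_of_carbonCost_eq_zero hvalid hcost i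
        rw [Finset.mem_Ico] at ht ⊢
        omega
    _ = B := by simp

/-- If the associated UCAS instance has a zero-cost schedule, `x` admits a 3-partition. -/
theorem zero_cost_schedule_to_threePartition
    (n B : ℕ) (hn : 0 < n) (hB : 0 < B) (x : Fin (3 * n) → ℕ)
    (hsum : ∑ i, x i = n * B)
    (hx : ∀ i, B < 4 * x i ∧ 2 * x i < B)
    (hsched : ∃ σ : Fin (3 * n) → ℕ, IsSchedule n B x σ ∧ carbonCost n B x σ = 0) :
    ThreePartition n B x := by
  obtain ⟨σ, hvalid, hcost⟩ := hsched
  have hblock (i : Fin (3 * n)) : σ i / (B + 1) < n := by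
    rw [Nat.div_lt_iff_lt_mul (Nat.succ_pos B), Nat.mul_succ]
    have hend := hvalid i
    have hpos := hx i
    unfold ucasT at hend
    omega
  let b (i : Fin (3 * n)) : Fin n := ⟨σ i / (B + 1), hblock i⟩
  refine ⟨fun k => {i | b i = k}, fun i => ⟨b i, by simp, fun k hk => ?_⟩, ?_⟩
  · exact ((Finset.mem_filter.mp hk).2).symm
  · have hle : ∀ k ∈ Finset.univ, ∑ i with b i = k, x i ≤ B := fun k _ => by
      simpa [b, Fin.ext_iff] using sum_block_le_of_carbonCost_eq_zero hvalid hcost k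
    have htotal : ∑ k, ∑ i with b i = k, x i = ∑ _k : Fin n, B := by
      rw [Finset.sum_fiberwise, hsum]
      simp
    exact fun k => (Finset.sum_eq_sum_iff_of_le hle).mp htotal k (Finset.mem_univ k)
end
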